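/- Let d, R ∈ ℕ with R ≥ 1. Let h : {1,…,d} → {1,…,R} be a random hash function whose values are pairwise independent and uniform on {1,…,R}, and let s : {1,…,d} → {−1,+1} be random signs that are pairwise independent, uniform, and independent of h. Define the CountSketch map Φ : ℝ^d → ℝ^R by (Φu)_r = Σ_{j : h(j)=r} s(j) u_j. Then for all u, v ∈ ℝ^d, E[⟨Φu, Φv⟩] = ⟨u, v⟩. -/

import Mathlib

open MeasureTheory ProbabilityTheory

/-- A random sign taking the value `1` with probability one half has mean zero. -/
theorem integral_eq_zero_of_uniform_sign {Ω : Type*} [MeasurableSpace Ω] {μ : Measure Ω}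
    [IsProbabilityMeasure μ] {X : Ω → ℝ} (hX : Measurable X)
    (hsign : ∀ ω, X ω = 1 ∨ X ω = -1) (hunif : μ {ω | X ω = 1} = 1 / 2) :
    ∫ ω, X ω ∂μ = 0 := by
  have hset : MeasurableSet {ω | X ω = 1} := hX (measurableSet_singleton 1)
  have hX_eq : X = fun ω => 2 * {ω | X ω = 1}.indicator (fun _ => (1 : ℝ)) ω - 1 := by
    funext ω
    rcases hsign ω with hω | hω <;> norm_num [Set.indicator, hω]
  have hint : Integrable ({ω | X ω = 1}.indicator fun _ => (1 : ℝ)) μ :=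
    (integrable_const 1).indicator hset
  rw [hX_eq, integral_sub (hint.const_mul 2) (integrable_const 1), integral_const_mul,
    integral_indicator_const _ hset, measureReal_def, hunif]
  simp

/-- The inner product of two sketches as a sum over pairs of coordinates hashed to the
same bucket. -/
theorem sum_bucket_mul_bucket {ι κ : Type*} [Fintype ι] [Fintype κ] [DecidableEq κ]
    (h : ι → κ) (a b : ι → ℝ) :
    ∑ r, (∑ j, if h j = r then a j else 0) * (∑ j, if h j = r then b j else 0)
      = ∑ j, ∑ k, (if h j = h k then 1 else 0) * (a j * b k) := by
  simp_rw [Finset.sum_mul_sum]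
  rw [Finset.sum_comm]
  refine Finset.sum_congr rfl fun j _ => ?_
  rw [Finset.sum_comm]
  refine Finset.sum_congr rfl fun k _ => ?_
  simp [ite_mul, eq_comm]

/-- CountSketch inner-product preservation (unbiasedness).  With a hash
`h : {1,…,d} → {1,…,R}` whose values are pairwise independent and uniform, and
signs `s : {1,…,d} → {±1}` that are pairwise independent, uniform and
independent of `h`, the sketch `(Φu)_r = Σ_{j : h j = r} s j · u j` satisfies
`E[⟨Φu, Φv⟩] = ⟨u, v⟩` for all `u, v ∈ ℝ^d`. -/
theorem countsketch_unbiased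
    {d R : ℕ} (hR : 1 ≤ R)
    {Ω : Type*} [MeasureSpace Ω] [IsProbabilityMeasure (ℙ : Measure Ω)]
    (h : Ω → Fin d → Fin R) (s : Ω → Fin d → ℝ)
    (hh_meas : Measurable h) (hs_meas : Measurable s)
    (hs_sign : ∀ ω j, s ω j = 1 ∨ s ω j = -1)
    (hh_unif : ∀ j r, ℙ {ω | h ω j = r} = 1 / R)
    (hs_unif : ∀ j, ℙ {ω | s ω j = 1} = 1 / 2)
    (hh_pairwise : ∀ j j' : Fin d, j ≠ j' →
      IndepFun (fun ω => h ω j) (fun ω => h ω j') ℙ)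
    (hs_pairwise : ∀ j j' : Fin d, j ≠ j' →
      IndepFun (fun ω => s ω j) (fun ω => s ω j') ℙ)
    (hhs_indep : IndepFun h s ℙ)
    (u v : Fin d → ℝ) :
    ∫ ω, ∑ r : Fin R,
        (∑ j : Fin d, if h ω j = r then s ω j * u j else 0) *
        (∑ j : Fin d, if h ω j = r then s ω j * v j else 0) ∂ℙ
      = ∑ j : Fin d, u j * v j := by
  have hs_meas' (j : Fin d) : Measurable fun ω => s ω j := (measurable_pi_apply j).comp hs_meas
  have hs_abs (ω : Ω) (j : Fin d) : |s ω j| = 1 := by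
    rcases hs_sign ω j with hω | hω <;> simp [hω]
  let c (j k : Fin d) (g : Fin d → Fin R) : ℝ := if g j = g k then 1 else 0
  have hc_meas (j k : Fin d) : Measurable (c j k) := .of_discrete
  have hss_meas (j k : Fin d) : Measurable fun t : Fin d → ℝ => t j * t k := by fun_prop
  have hpair (ω : Ω) : ∑ r : Fin R,
        (∑ j : Fin d, if h ω j = r then s ω j * u j else 0) *
        (∑ j : Fin d, if h ω j = r then s ω j * v j else 0)
      = ∑ j, ∑ k, c j k (h ω) * (s ω j * s ω k) * (u j * v k) := by
    rw [sum_bucket_mul_bucket]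
    refine Finset.sum_congr rfl fun j _ => Finset.sum_congr rfl fun k _ => ?_
    simp only [c]
    ring
  have hint (j k : Fin d) :
      Integrable (fun ω => c j k (h ω) * (s ω j * s ω k) * (u j * v k)) ℙ := by
    refine Integrable.mul_const (.of_bound (C := 1) ?_ (.of_forall fun ω => ?_)) _
    · exact (((hc_meas j k).comp hh_meas).mul
        ((hs_meas' j).mul (hs_meas' k))).aestronglyMeasurable
    · simp only [Real.norm_eq_abs, abs_mul, hs_abs, c]
      split_ifs <;> simp
  have hterm (j k : Fin d) :
      ∫ ω, c j k (h ω) * (s ω j * s ω k) * (u j * v k) ∂ℙ = if j = k then u j * v k else 0 := by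
    rw [integral_mul_const]
    split_ifs with hjk
    · subst hjk
      have hone (ω : Ω) : c j j (h ω) * (s ω j * s ω j) = 1 := by
        rw [← abs_mul_abs_self, hs_abs]
        simp [c]
      simp [hone]
    · have hcs : ∫ ω, c j k (h ω) * (s ω j * s ω k) ∂ℙ
          = (∫ ω, c j k (h ω) ∂ℙ) * ∫ ω, s ω j * s ω k ∂ℙ :=
        (hhs_indep.comp (hc_meas j k) (hss_meas j k)).integral_fun_mul_eq_mul_integral
          ((hc_meas j k).comp hh_meas).aestronglyMeasurable
          ((hss_meas j k).comp hs_meas).aestronglyMeasurable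
      rw [hcs, (hs_pairwise j k hjk).integral_fun_mul_eq_mul_integral
        (hs_meas' j).aestronglyMeasurable (hs_meas' k).aestronglyMeasurable,
        integral_eq_zero_of_uniform_sign (hs_meas' j) (fun ω => hs_sign ω j) (hs_unif j)]
      simp
  simp_rw [hpair]
  rw [integral_finsetSum _ fun j _ => integrable_finsetSum _ fun k _ => hint j k]
  refine Finset.sum_congr rfl fun j _ => ?_
  rw [integral_finsetSum _ fun k _ => hint j k]
  simp [hterm]
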